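/- Let p > 2, α = p−1 and θ ≥ 0 with k₀ = p−1 (i.e. p is an integer, p ≥ 3). Then σ_* = 0; in particular TMC(σ,α,θ) is attained for every σ ∈ (0, μ_{α,θ}). -/

import Mathlib

open MeasureTheory Real Filter ENNReal

/-- The fractional-dimension spherical volume constant `ω_θ = 2π^((θ+1)/2)/Γ((θ+1)/2)`. -/
noncomputable def omegaW (θ : ℝ) : ℝ := 2 * Real.pi ^ ((θ + 1) / 2) / Real.Gamma ((θ + 1) / 2)

/-- Weighted integral `∫₀^∞ f dλ_θ = ω_θ ∫₀^∞ f(r) r^θ dr` (for nonnegative integrands,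
valued in `ℝ≥0∞`). -/
noncomputable def wInt (θ : ℝ) (f : ℝ → ℝ) : ℝ≥0∞ :=
  ENNReal.ofReal (omegaW θ) *
    ∫⁻ r in Set.Ioi (0 : ℝ), ENNReal.ofReal (f r) * ENNReal.ofReal (r ^ θ)

/-- The weighted Lebesgue norm `‖u‖_{L^q_θ}` (valued in `ℝ≥0∞`). -/
noncomputable def wNorm (θ q : ℝ) (u : ℝ → ℝ) : ℝ≥0∞ :=
  (wInt θ fun r => |u r| ^ q) ^ (1 / q)

/-- Membership in the weighted Sobolev space `X = X^{1,p}_∞(α,θ)`: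
`u` is locally absolutely continuous on `(0,∞)` with a.e. derivative `u'`
(expressed through the fundamental theorem of calculus on compact subintervals),
`u(r) → 0` as `r → ∞`, `‖u‖_{L^p_θ} < ∞` and `‖u'‖_{L^p_α} < ∞`. -/
structure MemX (p α θ : ℝ) (u u' : ℝ → ℝ) : Prop where
  ftc_int : ∀ a b : ℝ, 0 < a → a ≤ b → IntervalIntegrable u' MeasureTheory.volume a b
  ftc : ∀ a b : ℝ, 0 < a → a ≤ b → u b - u a = ∫ t in a..b, u' t
  lim_zero : Filter.Tendsto u Filter.atTop (nhds 0)
  fin_u : wNorm θ p u < ⊤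
  fin_u' : wNorm α p u' < ⊤

/-- Full norm on `X`: `‖u‖ = (‖u‖_{L^p_θ}^p + ‖u'‖_{L^p_α}^p)^{1/p}`. -/
noncomputable def Xnorm (p α θ : ℝ) (u u' : ℝ → ℝ) : ℝ≥0∞ :=
  ((wNorm θ p u) ^ p + (wNorm α p u') ^ p) ^ (1 / p)

/-- The truncated exponential `φ_p(t) = Σ_{j ∈ ℕ, j ≥ p-1} t^j / j!`. -/
noncomputable def phiP (p t : ℝ) : ℝ :=
  ∑' j : ℕ, if p - 1 ≤ (j : ℝ) then t ^ j / (Nat.factorial j : ℝ) else 0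

/-- The critical constant `μ_{α,θ} = (θ+1) ω_α^{1/α}`. -/
noncomputable def muC (α θ : ℝ) : ℝ := (θ + 1) * (omegaW α) ^ (1 / α)

/-- The Trudinger–Moser functional `∫₀^∞ φ_p(μ |u|^{p/(p-1)}) dλ_θ`. -/
noncomputable def TMfunc (p θ μ : ℝ) (u : ℝ → ℝ) : ℝ≥0∞ :=
  wInt θ fun r => phiP p (μ * |u r| ^ (p / (p - 1)))

/-- The subcritical Trudinger–Moser supremum
`TMSC(μ,α,θ) = sup { ‖u‖_{L^p_θ}^{-p} ∫₀^∞ φ_p(μ|u|^{p/(p-1)}) dλ_θ : u ∈ X, u ≠ 0, ‖u'‖_{L^p_α} ≤ 1 }`. -/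
noncomputable def TMSC (p α θ μ : ℝ) : ℝ≥0∞ :=
  ⨆ (u : ℝ → ℝ) (u' : ℝ → ℝ) (_ : MemX p α θ u u') (_ : u ≠ 0)
    (_ : wNorm α p u' ≤ 1), (wNorm θ p u) ^ (-p) * TMfunc p θ μ u

/-- The critical Trudinger–Moser supremum
`TMC(σ,α,θ) = sup { ∫₀^∞ φ_p(σ|u|^{p/(p-1)}) dλ_θ : u ∈ X, ‖u‖ ≤ 1 }`. -/
noncomputable def TMC (p α θ σ : ℝ) : ℝ≥0∞ :=
  ⨆ (u : ℝ → ℝ) (u' : ℝ → ℝ) (_ : MemX p α θ u u') (_ : Xnorm p α θ u u' ≤ 1),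
    TMfunc p θ σ u

/-- `k₀ = min { j ∈ ℕ : j ≥ p - 1 }`. -/
noncomputable def k0 (p : ℝ) : ℕ := sInf {j : ℕ | p - 1 ≤ (j : ℝ)}

/-- `TMC(σ,α,θ)` is attained by some `u ∈ X` with `‖u‖ ≤ 1`. -/
def TMCAttained (p α θ σ : ℝ) : Prop :=
  ∃ u u' : ℝ → ℝ, MemX p α θ u u' ∧ Xnorm p α θ u u' ≤ 1 ∧
    TMC p α θ σ = TMfunc p θ σ u

/-- `σ_* = inf { σ ∈ (0, μ_{α,θ}) : TMC(σ,α,θ) is attained }`. -/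
noncomputable def sigmaStar (p α θ : ℝ) : ℝ :=
  sInf {σ : ℝ | σ ∈ Set.Ioo 0 (muC α θ) ∧ TMCAttained p α θ σ}

/-- `w` is an absolutely continuous function on the line with locally integrable
derivative `w'`. -/
structure IsPrimitive (w w' : ℝ → ℝ) : Prop where
  intervalIntegrable : ∀ a b : ℝ, IntervalIntegrable w' volume a b
  sub_eq : ∀ a b : ℝ, w b - w a = ∫ t in a..b, w' t

/-- The Dirichlet energy of order `m + 1` on the line. -/
noncomputable def lineEnergy (m : ℕ) (f : ℝ → ℝ) : ℝ≥0∞ := ∫⁻ t, ‖f t‖ₑ ^ (m + 1)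

/-- The mass of order `m + 1` on the line with exponential weight. -/
noncomputable def lineMass (m : ℕ) (κ : ℝ) (w : ℝ → ℝ) : ℝ≥0∞ :=
  ∫⁻ t, ‖w t‖ₑ ^ (m + 1) * ENNReal.ofReal (Real.exp (κ * t))

theorem IsPrimitive.continuous {w w' : ℝ → ℝ} (h : IsPrimitive w w') : Continuous w := by
  have h1 : w = fun t => w 0 + ∫ s in (0 : ℝ)..t, w' s := by
    ext t
    rw [← h.sub_eq 0 t]; ring
  rw [h1]
  exact continuous_const.add (intervalIntegral.continuous_primitive h.intervalIntegrable 0)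

theorem IsPrimitive.aemeasurable {w w' : ℝ → ℝ} (h : IsPrimitive w w') : AEMeasurable w' := by
  have h1 : AEMeasurable w' (volume.restrict (⋃ n : ℕ, Set.Ioc (-(n : ℝ)) n)) := by
    rw [aemeasurable_iUnion_iff]
    intro n
    exact (h.intervalIntegrable (-(n : ℝ)) n).1.aestronglyMeasurable.aemeasurable
  have h2 : (⋃ n : ℕ, Set.Ioc (-(n : ℝ)) n) = Set.univ := by
    ext x
    simp only [Set.mem_iUnion, Set.mem_Ioc, Set.mem_univ, iff_true]
    obtain ⟨n, hn⟩ := exists_nat_gt |x|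
    exact ⟨n, by linarith [neg_abs_le x], by linarith [le_abs_self x]⟩
  rwa [h2, Measure.restrict_univ] at h1

theorem IsPrimitive.enorm_sub_le {w w' : ℝ → ℝ} (h : IsPrimitive w w') {a b : ℝ} (hab : a ≤ b) :
    ‖w b - w a‖ₑ ≤ ∫⁻ t in Set.Ioc a b, ‖w' t‖ₑ := by
  rw [h.sub_eq, intervalIntegral.integral_of_le hab]
  exact enorm_integral_le_lintegral_enorm _

theorem lintegral_pow_succ_le {X : Type*} [MeasurableSpace X] (μ : Measure X) (m : ℕ)
    {f : X → ℝ≥0∞} (hf : AEMeasurable f μ) :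
    (∫⁻ x, f x ∂μ) ^ (m + 1) ≤ μ Set.univ ^ m * ∫⁻ x, f x ^ (m + 1) ∂μ := by
  rcases Nat.eq_zero_or_pos m with rfl | hm
  · simp
  have hm' : (0 : ℝ) < m := by exact_mod_cast hm
  have hc : ((m : ℝ) + 1).HolderConjugate (((m : ℝ) + 1) / m) := by
    rw [Real.holderConjugate_iff]
    refine ⟨by linarith, ?_⟩
    field_simp
    ring
  have h1 := ENNReal.lintegral_mul_le_Lp_mul_Lq μ hc hf (aemeasurable_const (b := (1 : ℝ≥0∞)))
  simp only [Pi.mul_apply, mul_one, ENNReal.one_rpow, lintegral_const, one_mul] at h1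
  have h2 : (∫⁻ x, f x ∂μ) ^ (m + 1) ≤ _ := pow_le_pow_left' h1 (m + 1)
  refine h2.trans (le_of_eq ?_)
  rw [mul_pow, mul_comm, ← ENNReal.rpow_natCast, ← ENNReal.rpow_natCast, ← ENNReal.rpow_mul,
    ← ENNReal.rpow_mul]
  have e1 : 1 / (((m : ℝ) + 1) / m) * ((m + 1 : ℕ) : ℝ) = m := by
    push_cast; field_simp
  have e2 : 1 / ((m : ℝ) + 1) * ((m + 1 : ℕ) : ℝ) = 1 := by
    push_cast; field_simp
  rw [e1, e2, ENNReal.rpow_one, ENNReal.rpow_natCast]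
  congr 1
  refine lintegral_congr fun x => ?_
  rw [← ENNReal.rpow_natCast]
  push_cast
  rfl

theorem IsPrimitive.enorm_sub_pow_le {w w' : ℝ → ℝ} (h : IsPrimitive w w') (m : ℕ) {a b : ℝ}
    (hab : a ≤ b) :
    ‖w b - w a‖ₑ ^ (m + 1) ≤
      ENNReal.ofReal (b - a) ^ m * ∫⁻ t in Set.Ioc a b, ‖w' t‖ₑ ^ (m + 1) := by
  refine (pow_le_pow_left' (h.enorm_sub_le hab) (m + 1)).trans ?_
  have := lintegral_pow_succ_le (volume.restrict (Set.Ioc a b)) m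
    (h.aemeasurable.enorm.restrict (s := Set.Ioc a b))
  simpa using this

theorem IsPrimitive.abs_sub_pow_le {w w' : ℝ → ℝ} (h : IsPrimitive w w') {m : ℕ} {E : ℝ}
    (hE : 0 ≤ E) (hw : lineEnergy m w' ≤ ENNReal.ofReal E) (a b : ℝ) :
    |w b - w a| ^ (m + 1) ≤ E * |b - a| ^ m := by
  wlog hab : a ≤ b generalizing a b
  · rw [abs_sub_comm, abs_sub_comm b a]
    exact this b a (by linarith)
  have h1 := (h.enorm_sub_pow_le m hab).trans
    (mul_le_mul_right ((setLIntegral_le_lintegral _ _).trans hw) _)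
  rw [abs_of_nonneg (sub_nonneg.2 hab), ← ENNReal.ofReal_le_ofReal_iff (by positivity)]
  rw [ENNReal.ofReal_mul hE, ENNReal.ofReal_pow (abs_nonneg _),
    ENNReal.ofReal_pow (sub_nonneg.2 hab), ← Real.enorm_eq_ofReal_abs, mul_comm]
  exact h1

theorem IsPrimitive.abs_sub_le {w w' : ℝ → ℝ} (h : IsPrimitive w w') {m : ℕ} {K : ℝ}
    (hK : 0 ≤ K) (hw : lineEnergy m w' ≤ ENNReal.ofReal (K ^ (m + 1))) (a b : ℝ) :
    |w b - w a| ≤ K * |b - a| ^ ((m : ℝ) / (m + 1)) := by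
  have h1 := h.abs_sub_pow_le (by positivity) hw a b
  refine le_of_pow_le_pow_left₀ (n := m + 1) (by omega) (by positivity) (h1.trans (le_of_eq ?_))
  rw [mul_pow]
  congr 1
  rw [← Real.rpow_natCast (_ ^ _) (m + 1), ← Real.rpow_mul (abs_nonneg _), ← Real.rpow_natCast]
  congr 1
  push_cast
  field_simp

theorem IsPrimitive.lintegral_translate_sub_le {w w' : ℝ → ℝ} (h : IsPrimitive w w') (m : ℕ)
    {s : ℝ} (hs : 0 ≤ s) :
    ∫⁻ t, ‖w (t + s) - w t‖ₑ ^ (m + 1) ≤ ENNReal.ofReal s ^ (m + 1) * lineEnergy m w' := by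
  obtain ⟨g, hg, hwg⟩ := h.aemeasurable
  have h1 : ∀ t, ‖w (t + s) - w t‖ₑ ^ (m + 1) ≤
      ENNReal.ofReal s ^ m * ∫⁻ x in Set.Ioc 0 s, ‖g (t + x)‖ₑ ^ (m + 1) := by
    intro t
    refine (h.enorm_sub_pow_le m (by linarith : t ≤ t + s)).trans (le_of_eq ?_)
    have h2 : ∫⁻ x in Set.Ioc t (t + s), ‖w' x‖ₑ ^ (m + 1) =
        ∫⁻ x in Set.Ioc t (t + s), ‖g x‖ₑ ^ (m + 1) :=
      lintegral_congr_ae (ae_restrict_of_ae (hwg.mono fun x hx => by simp only [hx]))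
    have h3 : ∫⁻ x in Set.Ioc t (t + s), ‖g x‖ₑ ^ (m + 1) =
        ∫⁻ x in Set.Ioc 0 s, ‖g (t + x)‖ₑ ^ (m + 1) := by
      rw [← lintegral_indicator measurableSet_Ioc, ← lintegral_indicator measurableSet_Ioc,
        ← lintegral_add_left_eq_self _ t]
      refine lintegral_congr fun x => ?_
      by_cases hx : x ∈ Set.Ioc 0 s
      · rw [Set.indicator_of_mem hx, Set.indicator_of_mem]
        exact ⟨by linarith [hx.1], by linarith [hx.2]⟩
      · rw [Set.indicator_of_notMem hx, Set.indicator_of_notMem]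
        exact fun hx' => hx ⟨by linarith [hx'.1], by linarith [hx'.2]⟩
    rw [h2, h3, add_sub_cancel_left]
  refine (lintegral_mono h1).trans ?_
  rw [lintegral_const_mul' _ _ (by simp), lintegral_lintegral_swap]
  · have h4 : ∀ x, ∫⁻ t, ‖g (t + x)‖ₑ ^ (m + 1) = lineEnergy m w' := by
      intro x
      rw [lintegral_add_right_eq_self (fun t => ‖g t‖ₑ ^ (m + 1)) x]
      exact lintegral_congr_ae (hwg.mono fun x hx => by simp only [hx])
    simp only [h4, lintegral_const, Measure.restrict_apply MeasurableSet.univ, Set.univ_inter,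
      Real.volume_Ioc, sub_zero]
    rw [pow_succ, mul_assoc, mul_comm (lineEnergy _ _)]
  · apply Measurable.aemeasurable
    simp only [Function.uncurry_def]
    fun_prop

theorem IsPrimitive.sum_dist_pow_le {w w' : ℝ → ℝ} (h : IsPrimitive w w') {m : ℕ} {C : ℝ}
    (hC : 0 ≤ C) (hw : lineEnergy m w' ≤ ENNReal.ofReal C) (n : ℕ) (I : ℕ → ℝ × ℝ)
    (hI : Set.PairwiseDisjoint (Finset.range n : Set ℕ) fun i => Set.uIoc (I i).1 (I i).2) :
    (∑ i ∈ Finset.range n, dist (w (I i).1) (w (I i).2)) ^ (m + 1) ≤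
      (∑ i ∈ Finset.range n, dist (I i).1 (I i).2) ^ m * C := by
  have hl : 0 ≤ ∑ i ∈ Finset.range n, dist (I i).1 (I i).2 :=
    Finset.sum_nonneg fun _ _ => dist_nonneg
  have hs : 0 ≤ ∑ i ∈ Finset.range n, dist (w (I i).1) (w (I i).2) :=
    Finset.sum_nonneg fun _ _ => dist_nonneg
  rw [← ENNReal.ofReal_le_ofReal_iff (by positivity), ENNReal.ofReal_pow hs,
    ENNReal.ofReal_mul (by positivity), ENNReal.ofReal_pow hl]
  set U := ⋃ i ∈ Finset.range n, Set.uIoc (I i).1 (I i).2 with hU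
  have h1 : ENNReal.ofReal (∑ i ∈ Finset.range n, dist (w (I i).1) (w (I i).2)) ≤
      ∫⁻ t in U, ‖w' t‖ₑ := by
    rw [hU, lintegral_biUnion_finset hI (fun i _ => measurableSet_uIoc),
      ENNReal.ofReal_sum_of_nonneg (fun _ _ => dist_nonneg)]
    refine Finset.sum_le_sum fun i _ => ?_
    rw [Real.dist_eq, ← Real.enorm_eq_ofReal_abs]
    rcases le_total (I i).1 (I i).2 with hle | hle
    · rw [enorm_sub_rev, Set.uIoc_of_le hle]
      exact h.enorm_sub_le hle
    · rw [Set.uIoc_of_ge hle]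
      exact h.enorm_sub_le hle
  have h2 : volume U ≤ ENNReal.ofReal (∑ i ∈ Finset.range n, dist (I i).1 (I i).2) := by
    rw [ENNReal.ofReal_sum_of_nonneg (fun _ _ => dist_nonneg)]
    refine (measure_biUnion_finset_le _ _).trans (Finset.sum_le_sum fun i _ => ?_)
    rw [Real.volume_uIoc, Real.dist_eq, abs_sub_comm]
  refine (pow_le_pow_left' h1 (m + 1)).trans ?_
  refine (lintegral_pow_succ_le (volume.restrict U) m
    (h.aemeasurable.enorm.restrict (s := U))).trans ?_
  rw [Measure.restrict_apply_univ]
  exact mul_le_mul' (pow_le_pow_left' h2 m) ((setLIntegral_le_lintegral _ _).trans hw)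

theorem exists_isPrimitive_of_tendsto {m : ℕ} (hm : 1 ≤ m) {C : ℝ} (hC : 0 ≤ C)
    {v v' : ℕ → ℝ → ℝ} (h : ∀ n, IsPrimitive (v n) (v' n))
    (hE : ∀ n, lineEnergy m (v' n) ≤ ENNReal.ofReal C) {w : ℝ → ℝ}
    (hlim : ∀ t, Tendsto (fun n => v n t) atTop (nhds (w t))) {e : ℝ≥0∞}
    (he : Tendsto (fun n => lineEnergy m (v' n)) atTop (nhds e)) :
    ∃ w' : ℝ → ℝ, IsPrimitive w w' ∧ lineEnergy m w' ≤ e := by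
  have hAC : ∀ a b, AbsolutelyContinuousOnInterval w a b := by
    intro a b
    rw [absolutelyContinuousOnInterval_iff]
    intro ε hε
    refine ⟨min 1 (ε ^ (m + 1) / (C + 1)), by positivity, fun E hEd hEl => ?_⟩
    have h1 : (∑ i ∈ Finset.range E.1, dist (w (E.2 i).1) (w (E.2 i).2)) ^ (m + 1) ≤
        (∑ i ∈ Finset.range E.1, dist (E.2 i).1 (E.2 i).2) ^ m * C := by
      refine le_of_tendsto (Tendsto.pow (tendsto_finsetSum _ fun i _ =>
        (hlim (E.2 i).1).dist (hlim (E.2 i).2)) (m + 1)) (Eventually.of_forall fun n => ?_)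
      exact (h n).sum_dist_pow_le hC (hE n) E.1 E.2 hEd.2
    set l := ∑ i ∈ Finset.range E.1, dist (E.2 i).1 (E.2 i).2
    have hl : 0 ≤ l := Finset.sum_nonneg fun _ _ => dist_nonneg
    have hl1 : l ≤ 1 := (hEl.trans_le (min_le_left _ _)).le
    have hl2 : l * (C + 1) < ε ^ (m + 1) := by
      have := hEl.trans_le (min_le_right _ _)
      rwa [lt_div_iff₀ (by positivity)] at this
    have h2 : l ^ m * C ≤ l * (C + 1) := by
      have : l ^ m ≤ l := pow_le_of_le_one hl hl1 (by omega)
      nlinarith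
    exact lt_of_pow_lt_pow_left₀ (m + 1) hε.le ((h1.trans h2).trans_lt hl2)
  have hP : IsPrimitive w (deriv w) :=
    ⟨fun a b => (hAC a b).intervalIntegrable_deriv,
      fun a b => (hAC a b).integral_deriv_eq_sub.symm⟩
  refine ⟨deriv w, hP, ?_⟩
  have hdiff : ∀ᵐ t : ℝ, DifferentiableAt ℝ w t := by
    have : ∀ᵐ t : ℝ, ∀ n : ℕ, t ∈ Set.uIcc (-(n : ℝ)) n → DifferentiableAt ℝ w t :=
      ae_all_iff.2 fun n => (hAC _ _).ae_differentiableAt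
    filter_upwards [this] with t ht
    obtain ⟨n, hn⟩ := exists_nat_gt |t|
    refine ht n ?_
    rw [Set.uIcc_of_le (by linarith [abs_nonneg t])]
    exact ⟨by linarith [neg_abs_le t], by linarith [le_abs_self t]⟩
  have hquot : ∀ s : ℝ, 0 < s →
      ∫⁻ t, ‖s⁻¹ * (w (t + s) - w t)‖ₑ ^ (m + 1) ≤ e := by
    intro s hs
    have hs' : ‖s⁻¹‖ₑ ^ (m + 1) * ENNReal.ofReal s ^ (m + 1) = 1 := by
      rw [← mul_pow, Real.enorm_eq_ofReal (by positivity), ← ENNReal.ofReal_mul (by positivity),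
        inv_mul_cancel₀ hs.ne', ENNReal.ofReal_one, one_pow]
    have h1 : ∀ n, ∫⁻ t, ‖s⁻¹ * (v n (t + s) - v n t)‖ₑ ^ (m + 1) ≤ lineEnergy m (v' n) := by
      intro n
      simp only [enorm_mul, mul_pow]
      rw [lintegral_const_mul' _ _ (by simp)]
      refine (mul_le_mul_right ((h n).lintegral_translate_sub_le m hs.le) _).trans ?_
      rw [← mul_assoc, hs', one_mul]
    have h2 : ∀ t, ‖s⁻¹ * (w (t + s) - w t)‖ₑ ^ (m + 1) =
        liminf (fun n => ‖s⁻¹ * (v n (t + s) - v n t)‖ₑ ^ (m + 1)) atTop := by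
      intro t
      have : Tendsto (fun n => s⁻¹ * (v n (t + s) - v n t)) atTop
          (nhds (s⁻¹ * (w (t + s) - w t))) := ((hlim _).sub (hlim _)).const_mul _
      exact (Tendsto.liminf_eq (ENNReal.Tendsto.pow this.enorm)).symm
    rw [lintegral_congr h2]
    refine (lintegral_liminf_le fun n => ?_).trans ?_
    · have := (h n).continuous
      fun_prop
    · rw [← he.liminf_eq]
      exact liminf_le_liminf (Eventually.of_forall h1)
  have hseq : Tendsto (fun k : ℕ => 1 / ((k : ℝ) + 1)) atTop (nhdsWithin 0 {0}ᶜ) :=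
    tendsto_nhdsWithin_iff.2 ⟨tendsto_one_div_add_atTop_nhds_zero_nat,
      Eventually.of_forall fun k => by
        have : (0 : ℝ) < 1 / ((k : ℝ) + 1) := by positivity
        exact this.ne'⟩
  have h3 : lineEnergy m (deriv w) = ∫⁻ t, liminf (fun k : ℕ =>
      ‖(1 / ((k : ℝ) + 1))⁻¹ * (w (t + 1 / ((k : ℝ) + 1)) - w t)‖ₑ ^ (m + 1)) atTop := by
    refine lintegral_congr_ae (hdiff.mono fun t ht => ?_)
    have h4 := (hasDerivAt_iff_tendsto_slope_zero.1 ht.hasDerivAt).comp hseq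
    exact (Tendsto.liminf_eq (ENNReal.Tendsto.pow h4.enorm)).symm
  rw [h3]
  refine (lintegral_liminf_le fun k => ?_).trans ?_
  · have := hP.continuous
    fun_prop
  · refine (liminf_le_liminf (v := fun _ => e) (Eventually.of_forall fun k => ?_)).trans ?_
    · exact hquot _ (by positivity)
    · simp

theorem exists_subseq_tendsto_of_uniform_modulus {v : ℕ → ℝ → ℝ} {M : ℝ → ℝ}
    (hM : ∀ n t, |v n t| ≤ M t)
    (hv : ∀ ε > 0, ∃ δ > 0, ∀ n a b, |b - a| < δ → |v n b - v n a| < ε) :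
    ∃ (φ : ℕ → ℕ) (w : ℝ → ℝ), StrictMono φ ∧
      ∀ t, Tendsto (fun n => v (φ n) t) atTop (nhds (w t)) := by
  have hc : IsCompact (Set.pi Set.univ fun q : ℚ => Set.Icc (-M q) (M q)) :=
    isCompact_univ_pi fun q => isCompact_Icc
  obtain ⟨x, -, φ, hφ, hx⟩ := hc.tendsto_subseq (x := fun n (q : ℚ) => v n q)
    (fun n q _ => abs_le.1 (hM n q))
  rw [tendsto_pi_nhds] at hx
  have hcau : ∀ t, ∃ l, Tendsto (fun n => v (φ n) t) atTop (nhds l) := by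
    intro t
    refine cauchySeq_tendsto_of_complete ?_
    rw [Metric.cauchySeq_iff]
    intro ε hε
    obtain ⟨δ, hδ, hvδ⟩ := hv (ε / 3) (by positivity)
    obtain ⟨q, hq1, hq2⟩ := exists_rat_btwn (show t < t + δ by linarith)
    have hq : |t - q| < δ := by rw [abs_lt]; constructor <;> linarith
    obtain ⟨N, hN⟩ := Metric.cauchySeq_iff.1 (hx q).cauchySeq (ε / 3) (by positivity)
    refine ⟨N, fun i hi j hj => ?_⟩
    have h1 := hN i hi j hj
    have h2 := hvδ (φ i) q t hq
    have h3 := hvδ (φ j) q t hq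
    simp only [Function.comp_apply, Real.dist_eq] at h1 ⊢
    rw [abs_lt] at *
    constructor <;> linarith
  choose w hw using hcau
  exact ⟨φ, w, hφ, hw⟩

theorem exists_uniform_modulus {m : ℕ} (hm : 1 ≤ m) {E : ℝ} (hE : 0 ≤ E) {ε : ℝ} (hε : 0 < ε) :
    ∃ δ > 0, ∀ w w' : ℝ → ℝ, IsPrimitive w w' → lineEnergy m w' ≤ ENNReal.ofReal E →
      ∀ a b, |b - a| < δ → |w b - w a| < ε := by
  refine ⟨min 1 (ε ^ (m + 1) / (E + 1)), by positivity, fun w w' h hw a b hab => ?_⟩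
  have h1 := h.abs_sub_pow_le hE hw a b
  have hl1 : |b - a| ≤ 1 := (hab.trans_le (min_le_left _ _)).le
  have hl2 : |b - a| * (E + 1) < ε ^ (m + 1) := by
    have := hab.trans_le (min_le_right _ _)
    rwa [lt_div_iff₀ (by positivity)] at this
  have h2 : |b - a| ^ m ≤ |b - a| := pow_le_of_le_one (abs_nonneg _) hl1 (by omega)
  refine lt_of_pow_lt_pow_left₀ (m + 1) hε.le ?_
  nlinarith [abs_nonneg (b - a)]

theorem exists_uniform_decay {m : ℕ} (hm : 1 ≤ m) {κ : ℝ} (hκ : 0 < κ) {E Q : ℝ} (hE : 0 ≤ E)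
    (hQ : 0 ≤ Q) {ε : ℝ} (hε : 0 < ε) :
    ∃ R : ℝ, 0 ≤ R ∧ ∀ w w' : ℝ → ℝ, IsPrimitive w w' → lineEnergy m w' ≤ ENNReal.ofReal E →
      lineMass m κ w ≤ ENNReal.ofReal Q → ∀ t, R ≤ t → |w t| ≤ ε := by
  obtain ⟨δ, hδ, hmod⟩ := exists_uniform_modulus hm hE (half_pos hε)
  refine ⟨(Q + 1) / ((ε / 2) ^ (m + 1) * (δ / 2) * κ), by positivity,
    fun w w' h hw hmass t ht => ?_⟩
  by_contra! hlt
  have h1 : ∀ s ∈ Set.Icc t (t + δ / 2), ENNReal.ofReal ((ε / 2) ^ (m + 1) * (κ * t)) ≤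
      ‖w s‖ₑ ^ (m + 1) * ENNReal.ofReal (Real.exp (κ * s)) := by
    intro s hs
    have h2 := hmod w w' h hw t s (by rw [abs_lt]; constructor <;> linarith [hs.1, hs.2])
    have h3 : ε / 2 ≤ |w s| := by
      have := abs_sub_abs_le_abs_sub (w t) (w s)
      rw [abs_sub_comm] at this
      linarith
    rw [ENNReal.ofReal_mul (by positivity), Real.enorm_eq_ofReal_abs,
      ← ENNReal.ofReal_pow (abs_nonneg _)]
    refine mul_le_mul' (ENNReal.ofReal_le_ofReal (pow_le_pow_left₀ (by positivity) h3 _))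
      (ENNReal.ofReal_le_ofReal ?_)
    have := Real.add_one_le_exp (κ * s)
    nlinarith [hs.1]
  have h4 := setLIntegral_mono' (μ := volume) measurableSet_Icc h1
  rw [setLIntegral_const, Real.volume_Icc, add_sub_cancel_left] at h4
  have h5 := h4.trans ((setLIntegral_le_lintegral _ _).trans hmass)
  have ht0 : 0 ≤ t := le_trans (by positivity) ht
  rw [← ENNReal.ofReal_mul (by positivity), ENNReal.ofReal_le_ofReal_iff hQ] at h5
  rw [div_le_iff₀ (by positivity)] at ht
  linarith

theorem exists_uniform_growth {m : ℕ} (hm : 1 ≤ m) {κ : ℝ} (hκ : 0 < κ) {K Q : ℝ} (hK : 0 ≤ K)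
    (hQ : 0 ≤ Q) :
    ∃ R : ℝ, 0 ≤ R ∧ ∀ w w' : ℝ → ℝ, IsPrimitive w w' →
      lineEnergy m w' ≤ ENNReal.ofReal (K ^ (m + 1)) →
      lineMass m κ w ≤ ENNReal.ofReal Q →
      ∀ t, |w t| ≤ 1 + K * (max (R - t) 0) ^ ((m : ℝ) / (m + 1)) := by
  obtain ⟨R, hR, hdec⟩ := exists_uniform_decay hm hκ (pow_nonneg hK (m + 1)) hQ one_pos
  refine ⟨R, hR, fun w w' h hw hmass t => ?_⟩
  rcases le_total R t with hRt | hRt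
  · exact (hdec w w' h hw hmass t hRt).trans (le_add_of_nonneg_right (by positivity))
  · have h1 := hdec w w' h hw hmass R le_rfl
    have h2 := h.abs_sub_le hK hw R t
    rw [max_eq_left (sub_nonneg.2 hRt)]
    rw [abs_sub_comm t R, abs_of_nonneg (sub_nonneg.2 hRt)] at h2
    have := abs_sub_abs_le_abs_sub (w t) (w R)
    linarith

/-- The exponential function minus its Taylor polynomial with `k` terms. -/
noncomputable def expTail (k : ℕ) (t : ℝ) : ℝ :=
  Real.exp t - ∑ j ∈ Finset.range k, t ^ j / (Nat.factorial j : ℝ)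

theorem hasSum_exp_real (t : ℝ) : HasSum (fun j : ℕ => t ^ j / (Nat.factorial j : ℝ))
    (Real.exp t) := by
  rw [Real.exp_eq_exp_ℝ]
  exact NormedSpace.expSeries_div_hasSum_exp t

theorem phiP_eq_expTail (m : ℕ) (t : ℝ) : phiP ((m : ℝ) + 1) t = expTail m t := by
  have h1 : HasSum (fun j : ℕ => if j ∈ Finset.range m then t ^ j / (Nat.factorial j : ℝ) else 0)
      (∑ j ∈ Finset.range m, t ^ j / (Nat.factorial j : ℝ)) := by
    have : HasSum (fun j : ℕ => if j ∈ Finset.range m then t ^ j / (Nat.factorial j : ℝ) else 0)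
        (∑ j ∈ Finset.range m,
          if j ∈ Finset.range m then t ^ j / (Nat.factorial j : ℝ) else 0) :=
      hasSum_sum_of_ne_finset_zero fun j hj => if_neg hj
    rwa [Finset.sum_congr rfl (g := fun j => t ^ j / (Nat.factorial j : ℝ))
      (fun j hj => if_pos hj)] at this
  have h2 := (hasSum_exp_real t).sub h1
  rw [phiP, expTail, ← h2.tsum_eq]
  refine tsum_congr fun j => ?_
  by_cases hj : j < m
  · simp [hj]
  · have : ((m : ℝ) + 1 - 1 ≤ (j : ℝ)) := by
      rw [add_sub_cancel_right, Nat.cast_le]; omega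
    rw [if_pos this, if_neg (by simpa using hj), sub_zero]

theorem expTail_eq_add_succ (k : ℕ) (t : ℝ) :
    expTail k t = t ^ k / (Nat.factorial k : ℝ) + expTail (k + 1) t := by
  rw [expTail, expTail, Finset.sum_range_succ]; ring

theorem continuous_expTail (k : ℕ) : Continuous (expTail k) := by
  unfold expTail
  fun_prop

theorem expTail_nonneg (k : ℕ) {t : ℝ} (ht : 0 ≤ t) : 0 ≤ expTail k t :=
  sub_nonneg.2 (Real.sum_le_exp_of_nonneg ht k)

theorem expTail_le_exp (k : ℕ) {t : ℝ} (ht : 0 ≤ t) : expTail k t ≤ Real.exp t :=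
  sub_le_self _ (Finset.sum_nonneg fun _ _ => by positivity)

theorem pow_div_factorial_le_expTail (k : ℕ) {t : ℝ} (ht : 0 ≤ t) :
    t ^ k / (Nat.factorial k : ℝ) ≤ expTail k t := by
  rw [expTail_eq_add_succ]
  exact le_add_of_nonneg_right (expTail_nonneg _ ht)

theorem expTail_le_pow_mul_exp (k : ℕ) {t : ℝ} (ht : 0 ≤ t) :
    expTail k t ≤ t ^ k * Real.exp t := by
  have h1 := (hasSum_nat_add_iff' (f := fun j : ℕ => t ^ j / (Nat.factorial j : ℝ)) k).2
    (hasSum_exp_real t)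
  refine hasSum_le (fun j => ?_) h1 ((hasSum_exp_real t).mul_left (t ^ k))
  rw [pow_add, mul_div_assoc', mul_comm (t ^ j)]
  refine div_le_div_of_nonneg_left (by positivity) (by positivity) ?_
  exact_mod_cast Nat.factorial_le (Nat.le_add_right j k)

/-- The part of the Trudinger–Moser functional of order higher than `m + 1`. -/
noncomputable def lineHigh (m : ℕ) (κ σ q : ℝ) (w : ℝ → ℝ) : ℝ≥0∞ :=
  ∫⁻ t, ENNReal.ofReal (expTail (m + 1) (σ * |w t| ^ q)) * ENNReal.ofReal (Real.exp (κ * t))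

theorem exists_expTail_le_mul_pow (m : ℕ) {σ q : ℝ} (hσ : 0 < σ) (hq : 0 < q)
    (hqm : q * m = m + 1) {ε : ℝ} (hε : 0 < ε) :
    ∃ δ > 0, ∀ x : ℝ, |x| ≤ δ → expTail (m + 1) (σ * |x| ^ q) ≤ ε * |x| ^ (m + 1) := by
  have hc : Continuous fun x : ℝ => σ ^ (m + 1) * |x| ^ q * Real.exp (σ * |x| ^ q) := by
    have : Continuous fun x : ℝ => |x| ^ q := continuous_abs.rpow_const fun _ => Or.inr hq.le
    fun_prop
  have h0 := hc.tendsto 0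
  simp only [abs_zero, Real.zero_rpow hq.ne', mul_zero, zero_mul] at h0
  obtain ⟨δ, hδ, h1⟩ := Metric.eventually_nhds_iff.1 (h0.eventually_lt_const hε)
  refine ⟨δ / 2, by positivity, fun x hx => ?_⟩
  have h2 := h1 (y := x) (by rw [Real.dist_eq, sub_zero]; linarith)
  have hp : (|x| ^ q) ^ (m + 1) = |x| ^ (m + 1) * |x| ^ q := by
    rw [pow_succ]
    congr 1
    rw [← Real.rpow_natCast, ← Real.rpow_natCast, ← Real.rpow_mul (abs_nonneg _), hqm]
    push_cast
    rfl
  refine (expTail_le_pow_mul_exp (m + 1) (by positivity)).trans ?_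
  rw [mul_pow, hp]
  nlinarith [pow_nonneg (abs_nonneg x) (m + 1)]

theorem exists_one_add_rpow_le {K σ κ q : ℝ} (hK : 0 < K) (hσ : 0 < σ) (hq : 0 < q)
    (hsub : σ * K ^ q < κ) :
    ∃ ν C : ℝ, 0 ≤ ν ∧ ν < κ ∧ ∀ s, 0 ≤ s → σ * (1 + K * s ^ (1 / q)) ^ q ≤ ν * s + C := by
  have hKq : 0 < σ * K ^ q := by positivity
  set ρ := (1 + κ / (σ * K ^ q)) / 2 with hρ
  have h1 : 1 < κ / (σ * K ^ q) := by rwa [one_lt_div hKq]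
  have hρ1 : 1 < ρ := by rw [hρ]; linarith
  have hρ2 : σ * K ^ q * ρ < κ := by
    have h3 : ρ < κ / (σ * K ^ q) := by rw [hρ]; linarith
    rw [lt_div_iff₀ hKq] at h3
    linarith
  set l := ρ ^ (1 / q) with hl
  have hl1 : 1 < l := Real.one_lt_rpow hρ1 (by positivity)
  have hlq : l ^ q = ρ := by
    rw [hl, ← Real.rpow_mul (by linarith), one_div_mul_cancel hq.ne', Real.rpow_one]
  refine ⟨σ * K ^ q * ρ, σ * (1 + 1 / (l - 1)) ^ q, by positivity, hρ2, fun s hs => ?_⟩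
  have hl0 : 0 < l - 1 := by linarith
  have hss : (s ^ (1 / q)) ^ q = s := by
    rw [← Real.rpow_mul hs, one_div_mul_cancel hq.ne', Real.rpow_one]
  have hC : 0 ≤ σ * (1 + 1 / (l - 1)) ^ q := by positivity
  have hX : 0 ≤ K * s ^ (1 / q) := by positivity
  rcases le_total 1 ((l - 1) * (K * s ^ (1 / q))) with h | h
  · have h4 : (1 + K * s ^ (1 / q)) ^ q ≤ (l * (K * s ^ (1 / q))) ^ q :=
      Real.rpow_le_rpow (by positivity) (by linarith) hq.le
    rw [Real.mul_rpow (by positivity) hX, Real.mul_rpow hK.le (by positivity), hss, hlq] at h4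
    nlinarith
  · have h4 : (1 + K * s ^ (1 / q)) ^ q ≤ (1 + 1 / (l - 1)) ^ q := by
      refine Real.rpow_le_rpow (by positivity) ?_ hq.le
      have : K * s ^ (1 / q) ≤ 1 / (l - 1) := by
        rw [le_div_iff₀ hl0]; linarith
      linarith
    have h5 : 0 ≤ σ * K ^ q * ρ * s := by positivity
    nlinarith

theorem le_lineHigh_of_tendsto {m : ℕ} (hm : 1 ≤ m) {κ σ q K Q : ℝ} (hκ : 0 < κ) (hσ : 0 < σ)
    (hq : 0 < q) (hqm : q * m = m + 1) (hK : 0 < K) (hQ : 0 ≤ Q) (hsub : σ * K ^ q < κ)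
    {v v' : ℕ → ℝ → ℝ} (h : ∀ n, IsPrimitive (v n) (v' n))
    (hE : ∀ n, lineEnergy m (v' n) ≤ ENNReal.ofReal (K ^ (m + 1)))
    (hM : ∀ n, lineMass m κ (v n) ≤ ENNReal.ofReal Q) {w : ℝ → ℝ}
    (hlim : ∀ t, Tendsto (fun n => v n t) atTop (nhds (w t))) {g : ℝ≥0∞}
    (hg : Tendsto (fun n => lineHigh m κ σ q (v n)) atTop (nhds g)) :
    g ≤ lineHigh m κ σ q w := by
  refine ENNReal.le_of_forall_pos_le_add fun ε hε _ => ?_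
  have hm0 : (0 : ℝ) < m := by exact_mod_cast hm
  obtain ⟨δ, hδ, hsmall⟩ := exists_expTail_le_mul_pow m hσ hq hqm
    (show 0 < (ε : ℝ) / (Q + 1) by positivity)
  obtain ⟨R₁, hR₁, hgrow⟩ := exists_uniform_growth hm hκ hK.le hQ
  obtain ⟨R₂, hR₂, hdec⟩ := exists_uniform_decay hm hκ (pow_nonneg hK.le (m + 1)) hQ hδ
  obtain ⟨ν, C, hν, hνκ, hC⟩ := exists_one_add_rpow_le hK hσ hq hsub
  have hqi : (m : ℝ) / (m + 1) = 1 / q := by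
    rw [← hqm]; field_simp
  set R := max R₁ R₂ with hR
  let F : (ℝ → ℝ) → ℝ → ℝ≥0∞ := fun u t =>
    ENNReal.ofReal (expTail (m + 1) (σ * |u t| ^ q)) * ENNReal.ofReal (Real.exp (κ * t))
  have hcont : Continuous fun x : ℝ => expTail (m + 1) (σ * |x| ^ q) := by
    have : Continuous fun x : ℝ => |x| ^ q := continuous_abs.rpow_const fun _ => Or.inr hq.le
    exact (continuous_expTail _).comp (by fun_prop)
  have hFmeas : ∀ n, Measurable (F (v n)) := by
    intro n
    have h1 : Continuous fun t => expTail (m + 1) (σ * |v n t| ^ q) :=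
      hcont.comp (h n).continuous
    exact h1.measurable.ennreal_ofReal.mul (by fun_prop)
  have htail : ∀ n, lineHigh m κ σ q (v n) ≤ (∫⁻ t in Set.Iic R, F (v n) t) + ε := by
    intro n
    have h1 : lineHigh m κ σ q (v n) =
        (∫⁻ t in Set.Iic R, F (v n) t) + ∫⁻ t in (Set.Iic R)ᶜ, F (v n) t :=
      (lintegral_add_compl _ measurableSet_Iic).symm
    rw [h1]
    refine add_le_add_right ?_ _
    have h2 : ∀ t ∈ (Set.Iic R)ᶜ, F (v n) t ≤ ENNReal.ofReal ((ε : ℝ) / (Q + 1)) *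
        (‖v n t‖ₑ ^ (m + 1) * ENNReal.ofReal (Real.exp (κ * t))) := by
      intro t ht
      rw [Set.compl_Iic, Set.mem_Ioi] at ht
      have h3 := hsmall _ (hdec _ _ (h n) (hE n) (hM n) t ((le_max_right _ _).trans ht.le))
      rw [← mul_assoc, Real.enorm_eq_ofReal_abs, ← ENNReal.ofReal_pow (abs_nonneg _),
        ← ENNReal.ofReal_mul (by positivity)]
      exact mul_le_mul_left (ENNReal.ofReal_le_ofReal h3) _
    refine (setLIntegral_mono' measurableSet_Iic.compl h2).trans ?_
    refine (setLIntegral_le_lintegral _ _).trans ?_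
    rw [lintegral_const_mul' _ _ ENNReal.ofReal_ne_top]
    refine (mul_le_mul_right (hM n) _).trans ?_
    rw [← ENNReal.ofReal_mul (by positivity), ← ENNReal.ofReal_coe_nnreal]
    refine ENNReal.ofReal_le_ofReal ?_
    rw [div_mul_eq_mul_div, div_le_iff₀ (by positivity)]
    nlinarith [ε.coe_nonneg]
  have hdct : Tendsto (fun n => ∫⁻ t in Set.Iic R, F (v n) t) atTop
      (nhds (∫⁻ t in Set.Iic R, F w t)) := by
    refine tendsto_lintegral_of_dominated_convergence
      (fun t => ENNReal.ofReal (Real.exp (C + ν * R) * Real.exp ((κ - ν) * t))) hFmeas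
      (fun n => ?_) ?_ (Eventually.of_forall fun t => ?_)
    · refine (ae_restrict_iff' measurableSet_Iic).2 (Eventually.of_forall fun t ht => ?_)
      have ht' : t ≤ R := ht
      have h1 := hgrow _ _ (h n) (hE n) (hM n) t
      rw [hqi] at h1
      have h2 : σ * |v n t| ^ q ≤ ν * (R - t) + C := by
        have h3 : max (R₁ - t) 0 ≤ R - t :=
          max_le (by linarith [le_max_left R₁ R₂]) (by linarith)
        have h4 := hC (max (R₁ - t) 0) (le_max_right _ _)
        have h5 : |v n t| ^ q ≤ (1 + K * max (R₁ - t) 0 ^ (1 / q)) ^ q :=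
          Real.rpow_le_rpow (abs_nonneg _) h1 hq.le
        nlinarith
      simp only [F]
      rw [← ENNReal.ofReal_mul (expTail_nonneg _ (by positivity))]
      refine ENNReal.ofReal_le_ofReal ?_
      calc expTail (m + 1) (σ * |v n t| ^ q) * Real.exp (κ * t)
          ≤ Real.exp (ν * (R - t) + C) * Real.exp (κ * t) := by
            refine mul_le_mul_of_nonneg_right ?_ (Real.exp_pos _).le
            exact (expTail_le_exp _ (by positivity)).trans (Real.exp_le_exp.2 h2)
        _ = Real.exp (C + ν * R) * Real.exp ((κ - ν) * t) := by
            rw [← Real.exp_add, ← Real.exp_add]; congr 1; ring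
    · refine (Integrable.lintegral_lt_top ?_).ne
      exact (integrableOn_exp_mul_Iic (by linarith) R).const_mul _
    · refine ENNReal.Tendsto.mul_const ?_ (Or.inr ENNReal.ofReal_ne_top)
      exact ENNReal.tendsto_ofReal ((hcont.tendsto _).comp (hlim t))
  refine (le_of_tendsto_of_tendsto' hg (hdct.add_const (ε : ℝ≥0∞)) htail).trans ?_
  exact add_le_add_left (setLIntegral_le_lintegral _ _) _

/-- The Trudinger–Moser functional in the logarithmic variable. -/
noncomputable def lineFunctional (m : ℕ) (κ σ q : ℝ) (w : ℝ → ℝ) : ℝ≥0∞ :=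
  ∫⁻ t, ENNReal.ofReal (expTail m (σ * |w t| ^ q)) * ENNReal.ofReal (Real.exp (κ * t))

theorem abs_rpow_pow_eq {m : ℕ} {q : ℝ} (hqm : q * m = m + 1) (x : ℝ) :
    (|x| ^ q) ^ m = |x| ^ (m + 1) := by
  rw [← Real.rpow_natCast, ← Real.rpow_mul (abs_nonneg _), hqm, ← Real.rpow_natCast]
  push_cast
  rfl

theorem lineFunctional_eq {m : ℕ} {κ σ q : ℝ} (hσ : 0 < σ) (hqm : q * m = m + 1) {w : ℝ → ℝ}
    (hw : Continuous w) :
    lineFunctional m κ σ q w =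
      ENNReal.ofReal (σ ^ m / (Nat.factorial m : ℝ)) * lineMass m κ w + lineHigh m κ σ q w := by
  rw [lineFunctional, lineMass, lineHigh, ← lintegral_const_mul _ (by fun_prop),
    ← lintegral_add_left (by fun_prop)]
  refine lintegral_congr fun t => ?_
  rw [← mul_assoc, ← add_mul]
  congr 1
  rw [expTail_eq_add_succ, ENNReal.ofReal_add (by positivity) (expTail_nonneg _ (by positivity)),
    mul_pow, abs_rpow_pow_eq hqm, Real.enorm_eq_ofReal_abs, ← ENNReal.ofReal_pow (abs_nonneg _),
    ← ENNReal.ofReal_mul (by positivity)]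
  congr 2
  ring

theorem lintegral_translate_mul_exp (κ τ : ℝ) (f : ℝ → ℝ≥0∞) :
    ∫⁻ t, f (t - τ) * ENNReal.ofReal (Real.exp (κ * t)) =
      ENNReal.ofReal (Real.exp (κ * τ)) * ∫⁻ t, f t * ENNReal.ofReal (Real.exp (κ * t)) := by
  rw [← lintegral_const_mul' _ _ ENNReal.ofReal_ne_top,
    ← lintegral_sub_right_eq_self (fun t => ENNReal.ofReal (Real.exp (κ * τ)) *
      (f t * ENNReal.ofReal (Real.exp (κ * t)))) τ]
  refine lintegral_congr fun t => ?_
  rw [mul_left_comm, ← ENNReal.ofReal_mul (by positivity), ← Real.exp_add]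
  congr 4
  ring

theorem IsPrimitive.translate {w w' : ℝ → ℝ} (h : IsPrimitive w w') (τ : ℝ) :
    IsPrimitive (fun t => w (t - τ)) fun t => w' (t - τ) := by
  refine ⟨fun a b => ?_, fun a b => ?_⟩
  · have := (h.intervalIntegrable (a - τ) (b - τ)).comp_sub_right τ
    simpa using this
  · rw [intervalIntegral.integral_comp_sub_right w' τ]
    exact h.sub_eq _ _

theorem lineEnergy_translate (m : ℕ) (f : ℝ → ℝ) (τ : ℝ) :
    lineEnergy m (fun t => f (t - τ)) = lineEnergy m f :=
  lintegral_sub_right_eq_self (fun t => ‖f t‖ₑ ^ (m + 1)) τ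

theorem lineMass_translate (m : ℕ) (κ : ℝ) (w : ℝ → ℝ) (τ : ℝ) :
    lineMass m κ (fun t => w (t - τ)) = ENNReal.ofReal (Real.exp (κ * τ)) * lineMass m κ w :=
  lintegral_translate_mul_exp κ τ fun t => ‖w t‖ₑ ^ (m + 1)

theorem lineHigh_translate (m : ℕ) (κ σ q : ℝ) (w : ℝ → ℝ) (τ : ℝ) :
    lineHigh m κ σ q (fun t => w (t - τ)) =
      ENNReal.ofReal (Real.exp (κ * τ)) * lineHigh m κ σ q w :=
  lintegral_translate_mul_exp κ τ fun t => ENNReal.ofReal (expTail (m + 1) (σ * |w t| ^ q))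

theorem IsPrimitive.const_mul {w w' : ℝ → ℝ} (h : IsPrimitive w w') (a : ℝ) :
    IsPrimitive (fun t => a * w t) fun t => a * w' t := by
  refine ⟨fun s t => (h.intervalIntegrable s t).const_mul a, fun s t => ?_⟩
  rw [intervalIntegral.integral_const_mul, ← h.sub_eq]
  ring

theorem lineEnergy_const_mul (m : ℕ) (f : ℝ → ℝ) {a : ℝ} (ha : 0 ≤ a) :
    lineEnergy m (fun t => a * f t) = ENNReal.ofReal (a ^ (m + 1)) * lineEnergy m f := by
  simp only [lineEnergy, enorm_mul, mul_pow]
  rw [lintegral_const_mul' _ _ (by simp), Real.enorm_eq_ofReal ha, ENNReal.ofReal_pow ha]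

theorem lineMass_const_mul (m : ℕ) (κ : ℝ) (w : ℝ → ℝ) {a : ℝ} (ha : 0 ≤ a) :
    lineMass m κ (fun t => a * w t) = ENNReal.ofReal (a ^ (m + 1)) * lineMass m κ w := by
  simp only [lineMass, enorm_mul, mul_pow, mul_assoc]
  rw [lintegral_const_mul' _ _ (by simp), Real.enorm_eq_ofReal ha, ENNReal.ofReal_pow ha]

theorem le_lineHigh_const_mul {m : ℕ} {κ σ q : ℝ} (hσ : 0 < σ)
    (hqm : q * m = m + 1) (w : ℝ → ℝ) {a : ℝ} (ha : 0 < a) :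
    ENNReal.ofReal (σ ^ (m + 1) / (Nat.factorial (m + 1) : ℝ) * (a ^ (m + 1) * a ^ q)) *
      ∫⁻ t, ENNReal.ofReal (|w t| ^ (m + 1) * |w t| ^ q) * ENNReal.ofReal (Real.exp (κ * t)) ≤
    lineHigh m κ σ q (fun t => a * w t) := by
  rw [← lintegral_const_mul' _ _ ENNReal.ofReal_ne_top]
  refine lintegral_mono fun t => ?_
  simp only
  rw [← mul_assoc, ← ENNReal.ofReal_mul (by positivity)]
  refine mul_le_mul_left (ENNReal.ofReal_le_ofReal ?_) _
  refine le_trans (le_of_eq ?_) (pow_div_factorial_le_expTail _ (by positivity))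
  rw [mul_pow, pow_succ (|a * w t| ^ q), abs_rpow_pow_eq hqm, abs_mul, abs_of_pos ha, mul_pow a,
    Real.mul_rpow ha.le (abs_nonneg _)]
  ring

theorem exists_test_function (m : ℕ) {κ : ℝ} :
    ∃ w w' : ℝ → ℝ, IsPrimitive w w' ∧ Tendsto w atTop (nhds 0) ∧ (∀ t, 0 < w t) ∧
      lineEnergy m w' < ⊤ ∧ lineMass m κ w < ⊤ := by
  have hd : ∀ t : ℝ, HasDerivAt (fun t : ℝ => Real.exp (-t ^ 2))
      (-(2 * t) * Real.exp (-t ^ 2)) t := by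
    intro t
    convert (hasDerivAt_pow 2 t).fun_neg.exp using 1
    push_cast
    ring
  refine ⟨fun t => Real.exp (-t ^ 2), fun t => -(2 * t) * Real.exp (-t ^ 2), ⟨fun a b => ?_,
    fun a b => ?_⟩, ?_, fun t => Real.exp_pos _, ?_, ?_⟩
  · exact Continuous.intervalIntegrable (by fun_prop) _ _
  · exact (intervalIntegral.integral_eq_sub_of_hasDerivAt (fun t _ => hd t)
      (Continuous.intervalIntegrable (by fun_prop) _ _)).symm
  · exact Real.tendsto_exp_atBot.comp
      (tendsto_neg_atTop_atBot.comp (tendsto_pow_atTop (by norm_num)))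
  · have hi : Integrable fun t : ℝ => 2 ^ (m + 1) * Real.exp (-(1 / 2) * t ^ 2) :=
      (integrable_exp_neg_mul_sq (by norm_num)).const_mul _
    refine lt_of_le_of_lt (lintegral_mono fun t => ?_) hi.lintegral_lt_top
    simp only
    rw [Real.enorm_eq_ofReal_abs, ← ENNReal.ofReal_pow (abs_nonneg _)]
    refine ENNReal.ofReal_le_ofReal ?_
    have h1 : |-(2 * t) * Real.exp (-t ^ 2)| ≤ 2 * Real.exp (-(1 / 2) * t ^ 2) := by
      have h2 : |t| ≤ Real.exp (1 / 2 * t ^ 2) := by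
        have := Real.add_one_le_exp (1 / 2 * t ^ 2)
        nlinarith [sq_abs t, sq_nonneg (|t| - 1)]
      have h3 : Real.exp (-(1 / 2) * t ^ 2) =
          Real.exp (1 / 2 * t ^ 2) * Real.exp (-t ^ 2) := by
        rw [← Real.exp_add]; congr 1; ring
      rw [abs_mul, abs_neg, abs_mul, abs_of_pos (Real.exp_pos _), h3, abs_two]
      nlinarith [Real.exp_pos (-t ^ 2)]
    refine (pow_le_pow_left₀ (abs_nonneg _) h1 _).trans ?_
    rw [mul_pow]
    refine mul_le_mul_of_nonneg_left ?_ (by positivity)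
    refine pow_le_of_le_one (Real.exp_pos _).le ?_ (by omega)
    rw [Real.exp_le_one_iff]
    nlinarith [sq_nonneg t]
  · have hi : Integrable fun t : ℝ => Real.exp (κ ^ 2) * Real.exp (-(1 / 2) * t ^ 2) :=
      (integrable_exp_neg_mul_sq (by norm_num)).const_mul _
    refine lt_of_le_of_lt (lintegral_mono fun t => ?_) hi.lintegral_lt_top
    simp only
    rw [Real.enorm_eq_ofReal_abs, ← ENNReal.ofReal_pow (abs_nonneg _), abs_of_pos (Real.exp_pos _),
      ← ENNReal.ofReal_mul (by positivity)]
    refine ENNReal.ofReal_le_ofReal ?_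
    have h1 : Real.exp (-t ^ 2) ^ (m + 1) ≤ Real.exp (-t ^ 2) := by
      refine pow_le_of_le_one (Real.exp_pos _).le ?_ (by omega)
      rw [Real.exp_le_one_iff]
      nlinarith [sq_nonneg t]
    calc Real.exp (-t ^ 2) ^ (m + 1) * Real.exp (κ * t)
        ≤ Real.exp (-t ^ 2) * Real.exp (κ * t) := by gcongr
      _ = Real.exp (-t ^ 2 + κ * t) := (Real.exp_add _ _).symm
      _ ≤ Real.exp (κ ^ 2 + -(1 / 2) * t ^ 2) :=
          Real.exp_le_exp.2 (by nlinarith [sq_nonneg (t - κ), sq_nonneg κ])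
      _ = _ := Real.exp_add _ _

/-- Admissible pairs for the maximization problem in the logarithmic variable. -/
structure IsAdmissible (m : ℕ) (A B κ : ℝ) (w w' : ℝ → ℝ) : Prop where
  isPrimitive : IsPrimitive w w'
  tendsto_zero : Tendsto w atTop (nhds 0)
  norm_le : ENNReal.ofReal A * lineMass m κ w + ENNReal.ofReal B * lineEnergy m w' ≤ 1

theorem exists_small_gain {m : ℕ} {q c d D : ℝ} (hd : 0 < d) (hqm : q < m + 1) :
    ∃ a > 0, D * a ^ (m + 1) < 1 ∧
      c < (c + d * a ^ q) * (1 - D * a ^ (m + 1)) := by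
  have hr : 0 < (m : ℝ) + 1 - q := by linarith
  have h1 : Continuous fun a : ℝ => D * a ^ (m + 1) := by fun_prop
  have h2 : Continuous fun a : ℝ => c * D * a ^ ((m : ℝ) + 1 - q) :=
    continuous_const.mul (continuous_id.rpow_const fun _ => Or.inr hr.le)
  have h1' := (h1.tendsto 0).eventually_lt_const (u := 1 / 2) (by simp)
  have h2' := (h2.tendsto 0).eventually_lt_const (u := d / 2)
    (by rw [Real.zero_rpow hr.ne']; simpa using hd)
  obtain ⟨r, hr0, hball⟩ := Metric.eventually_nhds_iff.1 (h1'.and h2')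
  have ha : 0 < r / 2 := by positivity
  obtain ⟨h3, h4⟩ := hball (y := r / 2) (by rw [Real.dist_eq, sub_zero, abs_of_pos ha]; linarith)
  refine ⟨r / 2, ha, by linarith, ?_⟩
  have h5 : (r / 2) ^ (m + 1) = (r / 2) ^ ((m : ℝ) + 1 - q) * (r / 2) ^ q := by
    rw [← Real.rpow_add ha, sub_add_cancel, ← Real.rpow_natCast]
    push_cast
    rfl
  have h6 : 0 < (r / 2) ^ q := by positivity
  have h7 : c * (D * (r / 2) ^ (m + 1)) < d / 2 * (r / 2) ^ q := by
    rw [h5]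
    nlinarith
  have h8 : d / 2 * (r / 2) ^ q ≤ d * (r / 2) ^ q * (1 - D * (r / 2) ^ (m + 1)) := by
    have : 0 < d * (r / 2) ^ q := by positivity
    nlinarith
  nlinarith

theorem exists_admissible_gt {m : ℕ} {A B κ σ q : ℝ} (hA : 0 < A) (hB : 0 < B)
    (hκ : 0 < κ) (hσ : 0 < σ) (hqm : q * m = m + 1) (hq : q < m + 1) :
    ∃ v v' : ℝ → ℝ, IsAdmissible m A B κ v v' ∧
      ENNReal.ofReal (σ ^ m / (Nat.factorial m : ℝ)) <
        ENNReal.ofReal A * lineFunctional m κ σ q v := by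
  obtain ⟨w, w', hw, hw0, hpos, hE, hM⟩ := exists_test_function m (κ := κ)
  have hwc := hw.continuous
  have hne : ∀ f : ℝ → ℝ≥0∞, Measurable f → (∀ t, f t ≠ 0) → ∫⁻ t, f t ≠ 0 := by
    intro f hf hf0 h
    rw [lintegral_eq_zero_iff hf] at h
    obtain ⟨t, ht⟩ := h.exists
    exact hf0 t ht
  have hM0 : lineMass m κ w ≠ 0 := by
    refine hne _ (by fun_prop) fun t => ?_
    have := (hpos t).ne'
    simp [this, Real.exp_pos]
  set Q := ∫⁻ t, ENNReal.ofReal (|w t| ^ (m + 1) * |w t| ^ q) *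
    ENNReal.ofReal (Real.exp (κ * t)) with hQdef
  have hQ0 : Q ≠ 0 := by
    refine hne _ (by fun_prop) fun t => ?_
    have h1 := abs_pos.2 (hpos t).ne'
    have h2 : 0 < |w t| ^ (m + 1) * |w t| ^ q := by positivity
    simp only [ne_eq, mul_eq_zero, ENNReal.ofReal_eq_zero, not_or, not_le]
    exact ⟨h2, Real.exp_pos _⟩
  obtain ⟨Q₁, hQ₁, hQQ⟩ : ∃ Q₁ : ℝ, 0 < Q₁ ∧ ENNReal.ofReal Q₁ ≤ Q := by
    have h1 : min Q 1 ≠ ⊤ := (min_le_right Q 1).trans_lt ENNReal.one_lt_top |>.ne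
    refine ⟨(min Q 1).toReal, ENNReal.toReal_pos ?_ h1, ?_⟩
    · exact (lt_min (pos_iff_ne_zero.2 hQ0) one_pos).ne'
    · rw [ENNReal.ofReal_toReal h1]
      exact min_le_left _ _
  set M := (lineMass m κ w).toReal with hMdef
  have hMpos : 0 < M := ENNReal.toReal_pos hM0 hM.ne
  have hMof : lineMass m κ w = ENNReal.ofReal M := (ENNReal.ofReal_toReal hM.ne).symm
  set E := (lineEnergy m w').toReal with hEdef
  have hEnn : 0 ≤ E := ENNReal.toReal_nonneg
  have hEof : lineEnergy m w' = ENNReal.ofReal E := (ENNReal.ofReal_toReal hE.ne).symm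
  set c := σ ^ m / (Nat.factorial m : ℝ) with hc
  have hcpos : 0 < c := by positivity
  set c₂ := σ ^ (m + 1) / (Nat.factorial (m + 1) : ℝ) with hc₂
  have hc₂pos : 0 < c₂ := by positivity
  obtain ⟨a, ha, ha1, hgain⟩ := exists_small_gain (m := m) (q := q) (c := c) (d := c₂ * Q₁ / M)
    (D := B * E) (by positivity) hq
  set s := 1 - B * E * a ^ (m + 1) with hs
  have hspos : 0 < s := by rw [hs]; linarith
  have hapow : 0 < a ^ (m + 1) := by positivity
  set τ := Real.log (s / (A * a ^ (m + 1) * M)) / κ with hτ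
  have hexp : Real.exp (κ * τ) = s / (A * a ^ (m + 1) * M) := by
    rw [hτ, mul_div_cancel₀ _ hκ.ne', Real.exp_log (by positivity)]
  have hmass : lineMass m κ (fun t => a * w (t - τ)) = ENNReal.ofReal (s / A) := by
    rw [lineMass_const_mul m κ (fun t => w (t - τ)) ha.le, lineMass_translate, hexp, hMof,
      ← ENNReal.ofReal_mul (by positivity), ← ENNReal.ofReal_mul (by positivity)]
    congr 1
    field_simp
  have hen : lineEnergy m (fun t => a * w' (t - τ)) = ENNReal.ofReal (a ^ (m + 1) * E) := by
    rw [lineEnergy_const_mul m (fun t => w' (t - τ)) ha.le, lineEnergy_translate, hEof,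
      ← ENNReal.ofReal_mul (by positivity)]
  have hprim : IsPrimitive (fun t => a * w (t - τ)) fun t => a * w' (t - τ) :=
    (hw.translate τ).const_mul a
  refine ⟨fun t => a * w (t - τ), fun t => a * w' (t - τ), ⟨hprim, ?_, ?_⟩, ?_⟩
  · have := (hw0.comp (tendsto_atTop_add_const_right atTop (-τ) tendsto_id)).const_mul a
    simpa [sub_eq_add_neg] using this
  · rw [hmass, hen, ← ENNReal.ofReal_mul hA.le, ← ENNReal.ofReal_mul hB.le,
      ← ENNReal.ofReal_add (by positivity) (by positivity), ← ENNReal.ofReal_one]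
    refine ENNReal.ofReal_le_ofReal (le_of_eq ?_)
    rw [mul_div_cancel₀ _ hA.ne', hs]
    ring
  · have hhigh : ENNReal.ofReal (c₂ * a ^ q * Q₁ / M * (s / A)) ≤
        lineHigh m κ σ q (fun t => a * w (t - τ)) := by
      refine le_trans ?_ (le_of_eq (lineHigh_translate m κ σ q (fun t => a * w t) τ).symm)
      refine le_trans ?_ (mul_le_mul_right (le_lineHigh_const_mul hσ hqm w ha) _)
      refine le_trans ?_ (mul_le_mul_right (mul_le_mul_right hQQ _) _)
      rw [hexp, ← ENNReal.ofReal_mul (by positivity), ← ENNReal.ofReal_mul (by positivity)]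
      refine ENNReal.ofReal_le_ofReal (le_of_eq ?_)
      rw [← hc₂]
      field_simp
    rw [lineFunctional_eq hσ hqm hprim.continuous, hmass]
    refine lt_of_lt_of_le ?_ (mul_le_mul_right (add_le_add_right hhigh _) _)
    rw [← ENNReal.ofReal_mul (by positivity), ← ENNReal.ofReal_add (by positivity) (by positivity),
      ← ENNReal.ofReal_mul hA.le, ENNReal.ofReal_lt_ofReal_iff (by positivity)]
    refine hgain.trans_le (le_of_eq ?_)
    rw [← hc]
    field_simp

theorem exists_lineFunctional_max {m : ℕ} (hm : 1 ≤ m) {A B κ σ q : ℝ} (hA : 0 < A) (hB : 0 < B)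
    (hκ : 0 < κ) (hσ : 0 < σ) (hq0 : 0 < q) (hqm : q * m = m + 1) (hq : q < m + 1)
    (hsub : σ < κ * B ^ (1 / (m : ℝ))) :
    ∃ w w' : ℝ → ℝ, IsAdmissible m A B κ w w' ∧ ∀ v v' : ℝ → ℝ, IsAdmissible m A B κ v v' →
      lineFunctional m κ σ q v ≤ lineFunctional m κ σ q w := by
  have hm0 : (0 : ℝ) < m := by exact_mod_cast hm
  have hA' : ENNReal.ofReal A ≠ 0 := by simpa using hA
  have hB' : ENNReal.ofReal B ≠ 0 := by simpa using hB
  set c := σ ^ m / (Nat.factorial m : ℝ) with hc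
  set T : Set ℝ≥0∞ := {x | ∃ v v' : ℝ → ℝ, IsAdmissible m A B κ v v' ∧
    lineFunctional m κ σ q v = x} with hT
  obtain ⟨v₀, v₀', hv₀, hgt⟩ := exists_admissible_gt hA hB hκ hσ hqm hq
  obtain ⟨x, -, hx, hxT⟩ := exists_seq_tendsto_sSup (S := T) ⟨_, v₀, v₀', hv₀, rfl⟩
    (OrderTop.bddAbove T)
  choose v v' hv hvx using hxT
  have hmassle : ∀ n, lineMass m κ (v n) ≤ ENNReal.ofReal (1 / A) := by
    intro n
    rw [one_div, ENNReal.ofReal_inv_of_pos hA, ENNReal.le_inv_iff_mul_le, mul_comm]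
    exact le_self_add.trans (hv n).norm_le
  set K := (1 / B) ^ (1 / ((m : ℝ) + 1)) with hK
  have hKpos : 0 < K := by positivity
  have hKpow : K ^ (m + 1) = 1 / B := by
    rw [hK, ← Real.rpow_natCast, ← Real.rpow_mul (by positivity)]
    push_cast
    rw [one_div_mul_cancel (by positivity), Real.rpow_one]
  have hKq : σ * K ^ q < κ := by
    have h1 : K ^ q = (B ^ (1 / (m : ℝ)))⁻¹ := by
      rw [hK, ← Real.rpow_mul (by positivity), one_div B, Real.inv_rpow hB.le]
      congr 2
      rw [← hqm]
      field_simp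
    rw [h1, ← div_eq_mul_inv, div_lt_iff₀ (by positivity)]
    exact hsub
  have henle : ∀ n, lineEnergy m (v' n) ≤ ENNReal.ofReal (K ^ (m + 1)) := by
    intro n
    rw [hKpow, one_div, ENNReal.ofReal_inv_of_pos hB, ENNReal.le_inv_iff_mul_le, mul_comm]
    exact le_add_self.trans (hv n).norm_le
  obtain ⟨R, hR, hgrow⟩ := exists_uniform_growth hm hκ hKpos.le (show 0 ≤ 1 / A by positivity)
  obtain ⟨φ₁, w, hφ₁, hw⟩ := exists_subseq_tendsto_of_uniform_modulus
    (fun n t => hgrow _ _ (hv n).isPrimitive (henle n) (hmassle n) t) (fun ε hε => by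
      obtain ⟨δ, hδ, h⟩ := exists_uniform_modulus hm (pow_nonneg hKpos.le (m + 1)) hε
      exact ⟨δ, hδ, fun n => h _ _ (hv n).isPrimitive (henle n)⟩)
  obtain ⟨⟨M, E, G⟩, φ₂, hφ₂, hlim⟩ := CompactSpace.tendsto_subseq (fun n =>
    (lineMass m κ (v (φ₁ n)), lineEnergy m (v' (φ₁ n)), lineHigh m κ σ q (v (φ₁ n))))
  set φ : ℕ → ℕ := fun n => φ₁ (φ₂ n) with hφ
  have hφlim : Tendsto φ atTop atTop := hφ₁.tendsto_atTop.comp hφ₂.tendsto_atTop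
  have hlimM : Tendsto (fun n => lineMass m κ (v (φ n))) atTop (nhds M) :=
    (continuous_fst.tendsto _).comp hlim
  have hlimE : Tendsto (fun n => lineEnergy m (v' (φ n))) atTop (nhds E) :=
    ((continuous_fst.comp continuous_snd).tendsto _).comp hlim
  have hlimG : Tendsto (fun n => lineHigh m κ σ q (v (φ n))) atTop (nhds G) :=
    ((continuous_snd.comp continuous_snd).tendsto _).comp hlim
  have hwφ : ∀ t, Tendsto (fun n => v (φ n) t) atTop (nhds (w t)) :=
    fun t => (hw t).comp hφ₂.tendsto_atTop
  obtain ⟨w', hprim, hwE⟩ := exists_isPrimitive_of_tendsto hm (pow_nonneg hKpos.le (m + 1))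
    (fun n => (hv (φ n)).isPrimitive) (fun n => henle (φ n)) hwφ hlimE
  have hGle : G ≤ lineHigh m κ σ q w :=
    le_lineHigh_of_tendsto hm hκ hσ hq0 hqm hKpos (by positivity) hKq
      (fun n => (hv (φ n)).isPrimitive) (fun n => henle (φ n)) (fun n => hmassle (φ n)) hwφ hlimG
  have hMle : M ≤ ENNReal.ofReal (1 / A) := le_of_tendsto' hlimM fun n => hmassle (φ n)
  have hwM : lineMass m κ w ≤ M := by
    have h1 : lineMass m κ w = ∫⁻ t, liminf (fun n =>
        ‖v (φ n) t‖ₑ ^ (m + 1) * ENNReal.ofReal (Real.exp (κ * t))) atTop := by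
      refine lintegral_congr fun t => ?_
      exact (Tendsto.liminf_eq (ENNReal.Tendsto.mul_const (ENNReal.Tendsto.pow (hwφ t).enorm)
        (Or.inr ENNReal.ofReal_ne_top))).symm
    rw [h1, ← hlimM.liminf_eq]
    refine lintegral_liminf_le fun n => ?_
    have := (hv (φ n)).isPrimitive.continuous
    fun_prop
  have hnorm : ENNReal.ofReal A * M + ENNReal.ofReal B * E ≤ 1 :=
    le_of_tendsto' ((ENNReal.Tendsto.const_mul hlimM (Or.inr ENNReal.ofReal_ne_top)).add
      (ENNReal.Tendsto.const_mul hlimE (Or.inr ENNReal.ofReal_ne_top)))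
      fun n => (hv (φ n)).norm_le
  have hS : sSup T ≤ ENNReal.ofReal c * M + lineHigh m κ σ q w := by
    refine le_trans (le_of_eq ?_) (add_le_add_right hGle _)
    refine tendsto_nhds_unique (hx.comp hφlim) ?_
    refine ((ENNReal.Tendsto.const_mul hlimM (Or.inr ENNReal.ofReal_ne_top)).add hlimG).congr
      fun n => ?_
    rw [Function.comp_apply, ← hvx, lineFunctional_eq hσ hqm (hv _).isPrimitive.continuous]
  have hwM0 : lineMass m κ w ≠ 0 := by
    intro h0
    have hzero : lineHigh m κ σ q w = 0 := by
      have hwc := hprim.continuous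
      rw [lineMass, lintegral_eq_zero_iff (by fun_prop)] at h0
      rw [lineHigh, lintegral_congr_ae (g := fun _ => 0), lintegral_zero]
      filter_upwards [h0] with t ht
      have h1 : w t = 0 := by
        have h2 : ‖w t‖ₑ ^ (m + 1) = 0 ∨ ENNReal.ofReal (Real.exp (κ * t)) = 0 := by
          simpa only [Pi.zero_apply, mul_eq_zero] using ht
        rcases h2 with h2 | h2
        · simpa using h2
        · exact absurd h2 (by simp [Real.exp_pos])
      have h3 : expTail (m + 1) 0 = 0 := by
        have h4 := expTail_le_pow_mul_exp (m + 1) (le_refl (0 : ℝ))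
        have h5 := expTail_nonneg (m + 1) (le_refl (0 : ℝ))
        rw [zero_pow (by omega), zero_mul] at h4
        exact le_antisymm h4 h5
      simp [h1, Real.zero_rpow hq0.ne', h3]
    have h1 : ENNReal.ofReal A * sSup T ≤ ENNReal.ofReal c := by
      rw [hzero, add_zero] at hS
      calc ENNReal.ofReal A * sSup T ≤ ENNReal.ofReal A * (ENNReal.ofReal c * M) :=
            mul_le_mul_right hS _
        _ = ENNReal.ofReal c * (ENNReal.ofReal A * M) := mul_left_comm _ _ _
        _ ≤ ENNReal.ofReal c * 1 := mul_le_mul_right (le_self_add.trans hnorm) _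
        _ = ENNReal.ofReal c := mul_one _
    have h2 : lineFunctional m κ σ q v₀ ≤ sSup T := le_sSup ⟨v₀, v₀', hv₀, rfl⟩
    exact absurd (hgt.trans_le ((mul_le_mul_right h2 _).trans h1)) (lt_irrefl _)
  have hMtop : M ≠ ⊤ := (hMle.trans_lt ENNReal.ofReal_lt_top).ne
  have hwMtop : lineMass m κ w ≠ ⊤ := (hwM.trans_lt hMtop.lt_top).ne
  have hM0 : M ≠ 0 := fun h => hwM0 (le_antisymm (h ▸ hwM) bot_le)
  have hmpos : 0 < (lineMass m κ w).toReal := ENNReal.toReal_pos hwM0 hwMtop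
  have hMpos : 0 < M.toReal := ENNReal.toReal_pos hM0 hMtop
  set l := M.toReal / (lineMass m κ w).toReal with hl
  have hl1 : 1 ≤ l := by
    rw [hl, one_le_div hmpos]
    exact ENNReal.toReal_mono hMtop hwM
  set τ := Real.log l / κ with hτ
  have hexp : Real.exp (κ * τ) = l := by
    rw [hτ, mul_div_cancel₀ _ hκ.ne', Real.exp_log (by linarith)]
  have hmassτ : lineMass m κ (fun t => w (t - τ)) = M := by
    rw [lineMass_translate, hexp, ← ENNReal.ofReal_toReal hwMtop,
      ← ENNReal.ofReal_mul (by linarith), hl, div_mul_cancel₀ _ hmpos.ne',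
      ENNReal.ofReal_toReal hMtop]
  have hdecay : Tendsto w atTop (nhds 0) := by
    rw [Metric.tendsto_atTop]
    intro ε hε
    obtain ⟨N, -, hN⟩ := exists_uniform_decay hm hκ (pow_nonneg hKpos.le (m + 1))
      (show 0 ≤ 1 / A by positivity) (half_pos hε)
    refine ⟨N, fun t ht => ?_⟩
    have h1 : |w t| ≤ ε / 2 := le_of_tendsto' (hwφ t).abs fun n =>
      hN _ _ (hv (φ n)).isPrimitive (henle (φ n)) (hmassle (φ n)) t ht
    rw [Real.dist_eq, sub_zero]
    linarith
  refine ⟨fun t => w (t - τ), fun t => w' (t - τ), ⟨hprim.translate τ, ?_, ?_⟩,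
    fun u u' hu => ?_⟩
  · have := hdecay.comp (tendsto_atTop_add_const_right atTop (-τ) tendsto_id)
    simpa [sub_eq_add_neg, Function.comp_def] using this
  · rw [hmassτ, lineEnergy_translate]
    exact (add_le_add_right (mul_le_mul_right hwE _) _).trans hnorm
  · refine (le_sSup (show _ ∈ T from ⟨u, u', hu, rfl⟩)).trans (hS.trans ?_)
    rw [lineFunctional_eq hσ hqm (hprim.translate τ).continuous, hmassτ, lineHigh_translate, hexp]
    refine add_le_add_right (le_mul_of_one_le_left' ?_) _
    rwa [ENNReal.one_le_ofReal]

theorem setLIntegral_Ioi_eq_lintegral_comp_exp (g : ℝ → ℝ≥0∞) :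
    ∫⁻ r in Set.Ioi (0 : ℝ), g r = ∫⁻ t, ENNReal.ofReal (Real.exp t) * g (Real.exp t) := by
  have h := lintegral_image_eq_lintegral_abs_deriv_mul MeasurableSet.univ
    (fun x _ => (Real.hasDerivAt_exp x).hasDerivWithinAt) Real.exp_injective.injOn g
  rw [Set.image_univ, Real.range_exp, Measure.restrict_univ] at h
  simpa only [Real.abs_exp] using h

theorem wInt_eq_lintegral_comp_exp (θ : ℝ) (f : ℝ → ℝ) :
    wInt θ f = ENNReal.ofReal (omegaW θ) *
      ∫⁻ t, ENNReal.ofReal (f (Real.exp t)) * ENNReal.ofReal (Real.exp ((θ + 1) * t)) := by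
  rw [wInt, setLIntegral_Ioi_eq_lintegral_comp_exp]
  congr 1
  refine lintegral_congr fun t => ?_
  rw [mul_left_comm, ← ENNReal.ofReal_mul (Real.exp_pos t).le]
  congr 2
  rw [← Real.exp_mul, ← Real.exp_add]
  congr 1
  ring

theorem ofReal_abs_rpow_succ (m : ℕ) (x : ℝ) :
    ENNReal.ofReal (|x| ^ ((m : ℝ) + 1)) = ‖x‖ₑ ^ (m + 1) := by
  rw [Real.enorm_eq_ofReal_abs, ← ENNReal.ofReal_pow (abs_nonneg x), ← Real.rpow_natCast]
  push_cast
  rfl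

theorem wNorm_rpow (θ : ℝ) {p : ℝ} (hp : p ≠ 0) (u : ℝ → ℝ) :
    wNorm θ p u ^ p = wInt θ fun r => |u r| ^ p := by
  rw [wNorm, ← ENNReal.rpow_mul, one_div_mul_cancel hp, ENNReal.rpow_one]

theorem wNorm_rpow_eq_lineMass (m : ℕ) (θ : ℝ) (u : ℝ → ℝ) :
    wNorm θ ((m : ℝ) + 1) u ^ ((m : ℝ) + 1) =
      ENNReal.ofReal (omegaW θ) * lineMass m (θ + 1) fun t => u (Real.exp t) := by
  rw [wNorm_rpow θ (by positivity), wInt_eq_lintegral_comp_exp, lineMass]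
  simp only [ofReal_abs_rpow_succ]

theorem wNorm_rpow_eq_lineEnergy (m : ℕ) (u' : ℝ → ℝ) :
    wNorm (m : ℝ) ((m : ℝ) + 1) u' ^ ((m : ℝ) + 1) =
      ENNReal.ofReal (omegaW m) * lineEnergy m fun t => Real.exp t * u' (Real.exp t) := by
  rw [wNorm_rpow _ (by positivity), wInt_eq_lintegral_comp_exp, lineEnergy]
  congr 1
  refine lintegral_congr fun t => ?_
  rw [ofReal_abs_rpow_succ, enorm_mul, mul_pow, mul_comm, Real.enorm_eq_ofReal_abs (Real.exp t),
    Real.abs_exp, ← ENNReal.ofReal_pow (Real.exp_pos t).le, ← Real.exp_nat_mul]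
  push_cast
  rfl

theorem Xnorm_le_one_iff (m : ℕ) (θ : ℝ) (u u' : ℝ → ℝ) :
    Xnorm ((m : ℝ) + 1) m θ u u' ≤ 1 ↔
      ENNReal.ofReal (omegaW θ) * lineMass m (θ + 1) (fun t => u (Real.exp t)) +
        ENNReal.ofReal (omegaW m) * lineEnergy m (fun t => Real.exp t * u' (Real.exp t)) ≤ 1 := by
  rw [Xnorm, wNorm_rpow_eq_lineMass, wNorm_rpow_eq_lineEnergy]
  have hp : (0 : ℝ) < 1 / ((m : ℝ) + 1) := by positivity
  conv_lhs => rw [← ENNReal.one_rpow (1 / ((m : ℝ) + 1))]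
  exact ENNReal.rpow_le_rpow_iff hp

theorem intervalIntegrable_comp_exp_iff (g : ℝ → ℝ) {a b : ℝ} (hab : a ≤ b) :
    IntervalIntegrable (fun t => Real.exp t * g (Real.exp t)) volume a b ↔
      IntervalIntegrable g volume (Real.exp a) (Real.exp b) := by
  rw [intervalIntegrable_iff_integrableOn_Ioc_of_le hab,
    intervalIntegrable_iff_integrableOn_Ioc_of_le (Real.exp_le_exp.2 hab), ← image_exp_Ioc,
    integrableOn_image_iff_integrableOn_abs_deriv_smul measurableSet_Ioc
      (fun x _ => (Real.hasDerivAt_exp x).hasDerivWithinAt) Real.exp_injective.injOn]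
  simp only [Real.abs_exp, smul_eq_mul]

theorem intervalIntegral_comp_exp (g : ℝ → ℝ) {a b : ℝ} (hab : a ≤ b) :
    ∫ t in a..b, Real.exp t * g (Real.exp t) = ∫ r in Real.exp a..Real.exp b, g r := by
  rw [intervalIntegral.integral_of_le hab,
    intervalIntegral.integral_of_le (Real.exp_le_exp.2 hab), ← image_exp_Ioc,
    integral_image_eq_integral_abs_deriv_smul measurableSet_Ioc
      (fun x _ => (Real.hasDerivAt_exp x).hasDerivWithinAt) Real.exp_injective.injOn]
  simp only [Real.abs_exp, smul_eq_mul]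

theorem isPrimitive_of_le {w w' : ℝ → ℝ}
    (hint : ∀ a b, a ≤ b → IntervalIntegrable w' volume a b)
    (hsub : ∀ a b, a ≤ b → w b - w a = ∫ t in a..b, w' t) : IsPrimitive w w' where
  intervalIntegrable a b := by
    rcases le_total a b with h | h
    · exact hint a b h
    · exact (hint b a h).symm
  sub_eq a b := by
    rcases le_total a b with h | h
    · exact hsub a b h
    · rw [intervalIntegral.integral_symm, ← hsub b a h, neg_sub]

theorem IsAdmissible.of_memX {m : ℕ} {θ : ℝ} {u u' : ℝ → ℝ} (h : MemX ((m : ℝ) + 1) m θ u u')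
    (hn : Xnorm ((m : ℝ) + 1) m θ u u' ≤ 1) :
    IsAdmissible m (omegaW θ) (omegaW m) (θ + 1) (fun t => u (Real.exp t))
      fun t => Real.exp t * u' (Real.exp t) where
  isPrimitive := isPrimitive_of_le
    (fun a b hab => (intervalIntegrable_comp_exp_iff u' hab).2
      (h.ftc_int _ _ (Real.exp_pos a) (Real.exp_le_exp.2 hab)))
    (fun a b hab => by
      rw [intervalIntegral_comp_exp u' hab]
      exact h.ftc _ _ (Real.exp_pos a) (Real.exp_le_exp.2 hab))
  tendsto_zero := h.lim_zero.comp Real.tendsto_exp_atTop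
  norm_le := (Xnorm_le_one_iff m θ u u').1 hn

theorem IsAdmissible.exists_memX {m : ℕ} {θ : ℝ} {w w' : ℝ → ℝ}
    (h : IsAdmissible m (omegaW θ) (omegaW m) (θ + 1) w w') :
    ∃ u u' : ℝ → ℝ, MemX ((m : ℝ) + 1) m θ u u' ∧ Xnorm ((m : ℝ) + 1) m θ u u' ≤ 1 ∧
      (fun t => u (Real.exp t)) = w := by
  set u : ℝ → ℝ := fun r => w (Real.log r) with hu
  set u' : ℝ → ℝ := fun r => w' (Real.log r) / r with hu'
  have hw : (fun t => u (Real.exp t)) = w := by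
    funext t
    simp only [hu, Real.log_exp]
  have hw' : (fun t => Real.exp t * u' (Real.exp t)) = w' := by
    funext t
    simp only [hu', Real.log_exp, mul_div_cancel₀ _ (Real.exp_pos t).ne']
  have hn : Xnorm ((m : ℝ) + 1) m θ u u' ≤ 1 := by
    rw [Xnorm_le_one_iff, hw, hw']
    exact h.norm_le
  have hp : (0 : ℝ) < (m : ℝ) + 1 := by positivity
  have hsum : wNorm θ ((m : ℝ) + 1) u ^ ((m : ℝ) + 1) +
      wNorm m ((m : ℝ) + 1) u' ^ ((m : ℝ) + 1) < ⊤ := by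
    rw [wNorm_rpow_eq_lineMass, wNorm_rpow_eq_lineEnergy, hw, hw']
    exact h.norm_le.trans_lt ENNReal.one_lt_top
  refine ⟨u, u', ⟨fun a b ha hab => ?_, fun a b ha hab => ?_, ?_, ?_, ?_⟩, hn, hw⟩
  · have h1 := h.isPrimitive.intervalIntegrable (Real.log a) (Real.log b)
    rw [← hw', intervalIntegrable_comp_exp_iff u' (Real.log_le_log ha hab), Real.exp_log ha,
      Real.exp_log (ha.trans_le hab)] at h1
    exact h1
  · have h1 := h.isPrimitive.sub_eq (Real.log a) (Real.log b)
    rw [← hw', intervalIntegral_comp_exp u' (Real.log_le_log ha hab), Real.exp_log ha,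
      Real.exp_log (ha.trans_le hab)] at h1
    exact h1
  · exact h.tendsto_zero.comp Real.tendsto_log_atTop
  · exact (ENNReal.rpow_lt_top_iff_of_pos hp).1 (le_self_add.trans_lt hsum)
  · exact (ENNReal.rpow_lt_top_iff_of_pos hp).1 (le_add_self.trans_lt hsum)

theorem TMfunc_eq_lineFunctional (m : ℕ) (θ σ : ℝ) (u : ℝ → ℝ) :
    TMfunc ((m : ℝ) + 1) θ σ u = ENNReal.ofReal (omegaW θ) *
      lineFunctional m (θ + 1) σ (((m : ℝ) + 1) / ((m : ℝ) + 1 - 1)) fun t => u (Real.exp t) := by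
  rw [TMfunc, wInt_eq_lintegral_comp_exp, lineFunctional]
  simp only [phiP_eq_expTail]

theorem omegaW_pos {θ : ℝ} (hθ : 0 ≤ θ) : 0 < omegaW θ := by
  have := Real.Gamma_pos_of_pos (show 0 < (θ + 1) / 2 by positivity)
  rw [omegaW]
  positivity

theorem TMCAttained_of_lt_muC {m : ℕ} (hm : 1 < m) {θ σ : ℝ} (hθ : 0 ≤ θ) (hσ : 0 < σ)
    (hσμ : σ < muC m θ) : TMCAttained ((m : ℝ) + 1) m θ σ := by
  have hm1 : (1 : ℝ) < m := by exact_mod_cast hm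
  have hm0 : (0 : ℝ) < m := by linarith
  have hq : ((m : ℝ) + 1) / ((m : ℝ) + 1 - 1) < m + 1 := by
    rw [add_sub_cancel_right]
    exact div_lt_self (by positivity) hm1
  have hqm : ((m : ℝ) + 1) / ((m : ℝ) + 1 - 1) * m = m + 1 := by
    rw [add_sub_cancel_right, div_mul_cancel₀ _ hm0.ne']
  have hq0 : 0 < ((m : ℝ) + 1) / ((m : ℝ) + 1 - 1) := by
    rw [add_sub_cancel_right]
    positivity
  obtain ⟨w, w', hw, hmax⟩ := exists_lineFunctional_max hm.le (omegaW_pos hθ)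
    (omegaW_pos hm0.le) (show 0 < θ + 1 by positivity) hσ hq0 hqm hq hσμ
  obtain ⟨u, u', hu, hn, huw⟩ := hw.exists_memX
  refine ⟨u, u', hu, hn, le_antisymm ?_ ?_⟩
  · refine iSup_le fun v => iSup_le fun v' => iSup_le fun hv => iSup_le fun hvn => ?_
    rw [TMfunc_eq_lineFunctional, TMfunc_eq_lineFunctional, huw]
    exact mul_le_mul_right (hmax _ _ (IsAdmissible.of_memX hv hvn)) _
  · exact le_iSup_of_le u (le_iSup_of_le u' (le_iSup_of_le hu (le_iSup_of_le hn le_rfl)))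

theorem stmt_11 (p α θ : ℝ) (hp : 2 < p) (hα : α = p - 1) (hθ : 0 ≤ θ)
    (hk : (k0 p : ℝ) = p - 1) :
    sigmaStar p α θ = 0 ∧ ∀ σ : ℝ, 0 < σ → σ < muC α θ → TMCAttained p α θ σ := by
  generalize k0 p = m at hk
  obtain rfl : α = m := hα.trans hk.symm
  obtain rfl : p = m + 1 := by linarith
  have hm : 1 < m := by
    have : (1 : ℝ) < m := by linarith
    exact_mod_cast this
  have hatt : ∀ σ : ℝ, 0 < σ → σ < muC m θ → TMCAttained ((m : ℝ) + 1) m θ σ :=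
    fun σ h0 h1 => TMCAttained_of_lt_muC hm hθ h0 h1
  refine ⟨?_, hatt⟩
  have hμ : 0 < muC m θ := by
    have := omegaW_pos (Nat.cast_nonneg (α := ℝ) m)
    rw [muC]
    positivity
  have hset : {σ : ℝ | σ ∈ Set.Ioo 0 (muC m θ) ∧ TMCAttained ((m : ℝ) + 1) m θ σ} =
      Set.Ioo 0 (muC m θ) :=
    Set.Subset.antisymm (fun σ h => h.1) fun σ h => ⟨h, hatt σ h.1 h.2⟩
  rw [sigmaStar, hset, csInf_Ioo hμ]
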